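/- Example 7.2: Define V : ℝ⁴ → ℝ by V(x) = ½·((7/2)x₁² − x₂² − (1/(2√2))x₄²) − (‖x‖² + 1)^{−1/2} (i.e. V(x) = ½⟨Bx,x⟩ − (‖x‖²+1)^{−1/2} with B = diag(7/2, −1, 0, −1/(2√2)); here the origin is a degenerate critical point of V). Then the Newtonian system ẍ = −∇V(x) has at least one non-stationary 2π-periodic solution. -/

import Mathlib

open Real

/-- A positive continuous periodic vector field on the line generates a global flow that advances
by one spatial period in time `∫ 1 / F`. -/
theorem exists_periodic_flow {F : ℝ → ℝ} {P : ℝ} (hP : 0 < P) (hF : Continuous F)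
    (hpos : ∀ x, 0 < F x) (hper : Function.Periodic F P) :
    ∃ φ : ℝ → ℝ, (∀ t, HasDerivAt φ (F (φ t)) t) ∧
      (∀ t, φ (t + ∫ x in (0 : ℝ)..P, (F x)⁻¹) = φ t + P) ∧ Function.Surjective φ := by
  have hc : Continuous fun x => (F x)⁻¹ := hF.inv₀ fun x => (hpos x).ne'
  have hint : ∀ a b, IntervalIntegrable (fun x => (F x)⁻¹) MeasureTheory.volume a b :=
    fun a b => hc.intervalIntegrable a b
  have hper' : Function.Periodic (fun x => (F x)⁻¹) P := fun x => by simp only [hper x]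
  set τ : ℝ → ℝ := fun x => ∫ s in (0 : ℝ)..x, (F s)⁻¹ with hτ
  have hd : ∀ x, HasDerivAt τ (F x)⁻¹ x := fun x => hc.integral_hasStrictDerivAt 0 x |>.hasDerivAt
  have hmono : StrictMono τ := strictMono_of_deriv_pos fun x => by
    rw [(hd x).deriv]; exact inv_pos.2 (hpos x)
  have hcont : Continuous τ := continuous_iff_continuousAt.2 fun x => (hd x).continuousAt
  have hsurj : Function.Surjective τ := hcont.surjective
    (hper'.tendsto_atTop_intervalIntegral_of_pos' (hint 0 P) (fun x => inv_pos.2 (hpos x)) hP)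
    (hper'.tendsto_atBot_intervalIntegral_of_pos' (hint 0 P) (fun x => inv_pos.2 (hpos x)) hP)
  let e : ℝ ≃o ℝ := hmono.orderIsoOfSurjective τ hsurj
  have he : ∀ t, τ (e.symm t) = t := fun t => e.apply_symm_apply t
  refine ⟨e.symm, fun t => ?_, fun t => hmono.injective ?_, e.symm.surjective⟩
  · have h := (hd (e.symm t)).of_local_left_inverse e.symm.continuous.continuousAt
      (inv_ne_zero (hpos _).ne') (Filter.Eventually.of_forall he)
    simpa using h
  · have h := hper'.intervalIntegral_add_eq_add 0 (e.symm t) hint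
    rw [zero_add] at h
    exact (he _).trans ((congrArg (· + _) (he t)).symm.trans h.symm)

/-- Squared angular speed of the phase `φ` in the ansatz `y = A sin φ` for the equation
`y'' = -y (7 / 2 + (y ^ 2 + 1) ^ (-3 / 2))`. -/
noncomputable def phaseSpeedSq (A x : ℝ) : ℝ :=
  7 / 2 + 2 / (√(1 + A ^ 2) * √(1 + (A * sin x) ^ 2) * (√(1 + A ^ 2) + √(1 + (A * sin x) ^ 2)))

theorem phaseSpeedSq_pos (A x : ℝ) : 0 < phaseSpeedSq A x := by
  unfold phaseSpeedSq; positivity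

theorem continuous_phaseSpeedSq : Continuous fun p : ℝ × ℝ => phaseSpeedSq p.1 p.2 := by
  unfold phaseSpeedSq
  refine continuous_const.add (continuous_const.div (by fun_prop) fun p => ?_)
  positivity

theorem phaseSpeedSq_zero (x : ℝ) : phaseSpeedSq 0 x = 9 / 2 := by
  norm_num [phaseSpeedSq]

theorem phaseSpeedSq_two_lt (x : ℝ) : phaseSpeedSq 2 x < 4 := by
  have h1 : 2 ≤ √(1 + (2 : ℝ) ^ 2) := Real.le_sqrt_of_sq_le (by norm_num)
  have h2 : 1 ≤ √(1 + (2 * sin x) ^ 2) := Real.le_sqrt_of_sq_le (by nlinarith [sq_nonneg (sin x)])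
  unfold phaseSpeedSq
  generalize √(1 + (2 : ℝ) ^ 2) = s at *
  generalize √(1 + (2 * sin x) ^ 2) = σ at *
  have h3 : 2 ≤ s * σ := by nlinarith
  have h4 : 6 ≤ s * σ * (s + σ) := by nlinarith
  have : 2 / (s * σ * (s + σ)) ≤ 2 / 6 := by gcongr
  linarith

theorem exists_amplitude : ∃ A : ℝ, A ≠ 0 ∧
    ∫ x in (0 : ℝ)..(2 * π), (√(phaseSpeedSq A x))⁻¹ = π := by
  have hne : ∀ A x, √(phaseSpeedSq A x) ≠ 0 := fun A x => (sqrt_pos.2 (phaseSpeedSq_pos A x)).ne'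
  have hc : Continuous fun p : ℝ × ℝ => (√(phaseSpeedSq p.1 p.2))⁻¹ :=
    continuous_phaseSpeedSq.sqrt.inv₀ fun p => hne _ _
  have hT : Continuous fun A => ∫ x in (0 : ℝ)..(2 * π), (√(phaseSpeedSq A x))⁻¹ :=
    intervalIntegral.continuous_parametric_intervalIntegral_of_continuous' hc _ _
  have h0 : ∫ x in (0 : ℝ)..(2 * π), (√(phaseSpeedSq 0 x))⁻¹ < π := by
    have : (√(9 / 2 : ℝ))⁻¹ < 2⁻¹ :=
      inv_strictAnti₀ two_pos (Real.lt_sqrt_of_sq_lt (by norm_num))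
    simp only [phaseSpeedSq_zero, intervalIntegral.integral_const, smul_eq_mul, sub_zero]
    nlinarith [pi_pos]
  have h2 : π ≤ ∫ x in (0 : ℝ)..(2 * π), (√(phaseSpeedSq 2 x))⁻¹ := by
    calc π = ∫ x in (0 : ℝ)..(2 * π), (2 : ℝ)⁻¹ := by
          rw [intervalIntegral.integral_const, smul_eq_mul]; ring
      _ ≤ _ := by
          refine intervalIntegral.integral_mono_on (by positivity) (by simp)
            ((hc.comp (Continuous.prodMk_right (2 : ℝ))).intervalIntegrable _ _) fun x _ => ?_
          refine inv_anti₀ (sqrt_pos.2 (phaseSpeedSq_pos 2 x)) ?_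
          exact Real.sqrt_le_iff.2 ⟨two_pos.le, by linarith [phaseSpeedSq_two_lt x]⟩
  obtain ⟨A, -, hA⟩ := intermediate_value_Icc (zero_le_two (α := ℝ)) hT.continuousOn ⟨h0.le, h2⟩
  refine ⟨A, ?_, hA⟩
  rintro rfl
  exact h0.ne hA

theorem hasDerivAt_cos_mul_sqrt_phaseSpeedSq (A x : ℝ) :
    HasDerivAt (fun x => A * cos x * √(phaseSpeedSq A x))
      (-(A * sin x) * (7 / 2 + (√(1 + (A * sin x) ^ 2) ^ 3)⁻¹) / √(phaseSpeedSq A x)) x := by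
  have hs : 0 < √(1 + A ^ 2) := by positivity
  have hσ : 0 < √(1 + (A * sin x) ^ 2) := by positivity
  have hH := phaseSpeedSq_pos A x
  have hF : 0 < √(phaseSpeedSq A x) := sqrt_pos.2 hH
  have dσ : HasDerivAt (fun x => √(1 + (A * sin x) ^ 2))
      (A ^ 2 * sin x * cos x / √(1 + (A * sin x) ^ 2)) x := by
    refine (((((hasDerivAt_sin x).const_mul A).pow 2).const_add 1).sqrt
      (by simp only [Pi.pow_apply]; positivity)).congr_deriv ?_
    simp only [Pi.pow_apply]
    field_simp
    norm_num
    ring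
  have dH : HasDerivAt (phaseSpeedSq A) (-2 * (√(1 + A ^ 2) + 2 * √(1 + (A * sin x) ^ 2)) /
      (√(1 + A ^ 2) * √(1 + (A * sin x) ^ 2) ^ 2 * (√(1 + A ^ 2) + √(1 + (A * sin x) ^ 2)) ^ 2) *
      (A ^ 2 * sin x * cos x / √(1 + (A * sin x) ^ 2))) x := by
    have h := ((hasDerivAt_const x (2 : ℝ)).div
      ((dσ.const_mul √(1 + A ^ 2)).mul (dσ.const_add √(1 + A ^ 2)))
      (by simp only [Pi.mul_apply]; positivity)).const_add
      (7 / 2)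
    refine HasDerivAt.congr_deriv (h.congr_of_eventuallyEq ?_) ?_
    · exact Filter.Eventually.of_forall fun y => rfl
    · simp only [Pi.mul_apply]
      field_simp
      ring
  have h := ((hasDerivAt_cos x).const_mul A).mul (dH.sqrt hH.ne')
  refine h.congr_deriv ?_
  have hsq := Real.sq_sqrt hH.le
  have e1 : A ^ 2 * cos x ^ 2 = √(1 + A ^ 2) ^ 2 - √(1 + (A * sin x) ^ 2) ^ 2 := by
    rw [Real.sq_sqrt (by positivity), Real.sq_sqrt (by positivity), cos_sq']; ring
  rw [eq_div_iff hF.ne']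
  have e2 : (A * -sin x * √(phaseSpeedSq A x)) * √(phaseSpeedSq A x) =
      -(A * sin x) * phaseSpeedSq A x := by linear_combination (-(A * sin x)) * hsq
  rw [add_mul, e2]
  unfold phaseSpeedSq at hF ⊢
  generalize √(1 + A ^ 2) = s at *
  generalize √(1 + (A * sin x) ^ 2) = σ at *
  generalize √(7 / 2 + 2 / (s * σ * (s + σ))) = F at *
  have e3 : A * cos x * (-2 * (s + 2 * σ) / (s * σ ^ 2 * (s + σ) ^ 2) *
      (A ^ 2 * sin x * cos x / σ) / (2 * F)) * F =
      -(A * sin x) * ((A ^ 2 * cos x ^ 2) * (s + 2 * σ) / (s * σ ^ 3 * (s + σ) ^ 2)) := by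
    field_simp
  rw [e3, e1]
  field_simp
  ring

/-- The scalar equation `y'' = -y (7 / 2 + (y ^ 2 + 1) ^ (-3 / 2))` has a non-constant solution of
period `π`. -/
theorem exists_scalar_solution : ∃ y y' : ℝ → ℝ,
    (∀ t, HasDerivAt y (y' t) t) ∧
    (∀ t, HasDerivAt y' (-(y t * (7 / 2 + (√(1 + y t ^ 2) ^ 3)⁻¹))) t) ∧
    (∀ t, y (t + π) = y t) ∧ ∃ t₁ t₂, y t₁ ≠ y t₂ := by
  obtain ⟨A, hA, hAπ⟩ := exists_amplitude
  have hpos : ∀ x, 0 < √(phaseSpeedSq A x) := fun x => sqrt_pos.2 (phaseSpeedSq_pos A x)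
  obtain ⟨φ, hφ, hφper, hφsurj⟩ := exists_periodic_flow two_pi_pos
    (continuous_phaseSpeedSq.comp (Continuous.prodMk_right A)).sqrt hpos
    (fun x => by simp [phaseSpeedSq])
  refine ⟨fun t => A * sin (φ t), fun t => A * cos (φ t) * √(phaseSpeedSq A (φ t)),
    fun t => ?_, fun t => ?_, fun t => ?_, ?_⟩
  · exact ((hφ t).sin.const_mul A).congr_deriv (by ring_nf; rfl)
  · refine ((hasDerivAt_cos_mul_sqrt_phaseSpeedSq A (φ t)).comp t (hφ t)).congr_deriv ?_
    have := (hpos (φ t)).ne'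
    simp only [Function.comp_apply]
    rw [div_mul_cancel₀ _ this]
    ring
  · have h := hφper t
    simp only [Function.comp_apply] at h
    rw [hAπ] at h
    simp only [h, sin_add_two_pi]
  · obtain ⟨t₁, h₁⟩ := hφsurj (π / 2)
    obtain ⟨t₂, h₂⟩ := hφsurj 0
    exact ⟨t₁, t₂, by simpa [h₁, h₂] using hA⟩

theorem hasGradientAt_potential (V : EuclideanSpace ℝ (Fin 4) → ℝ)
    (hVdef : ∀ x : EuclideanSpace ℝ (Fin 4),
      V x = (1 / 2 : ℝ) * ((7 / 2) * (x 0) ^ 2 - 1 * (x 1) ^ 2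
          - (1 / (2 * Real.sqrt 2)) * (x 3) ^ 2)
        - (‖x‖ ^ 2 + 1) ^ (-(1 : ℝ) / 2)) (y : ℝ) :
    HasGradientAt V ((y * (7 / 2 + (√(1 + y ^ 2) ^ 3)⁻¹)) • EuclideanSpace.single 0 (1 : ℝ))
      (y • EuclideanSpace.single 0 (1 : ℝ)) := by
  set x : EuclideanSpace ℝ (Fin 4) := y • EuclideanSpace.single 0 (1 : ℝ) with hx
  have hV : V = fun x => _ := funext hVdef
  rw [hV, hasGradientAt_iff_hasFDerivAt]
  have hp : ∀ i : Fin 4, HasFDerivAt (fun x : EuclideanSpace ℝ (Fin 4) => x i)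
      (EuclideanSpace.proj i : EuclideanSpace ℝ (Fin 4) →L[ℝ] ℝ) x :=
    fun i => (EuclideanSpace.proj i : EuclideanSpace ℝ (Fin 4) →L[ℝ] ℝ).hasFDerivAt
  have hn : HasFDerivAt (fun x : EuclideanSpace ℝ (Fin 4) => ‖x‖ ^ 2 + 1) (2 • innerSL ℝ x) x :=
    (hasStrictFDerivAt_norm_sq x).hasFDerivAt.add_const 1
  have h := ((((((hp 0).pow 2).const_mul (7 / 2 : ℝ)).sub (((hp 1).pow 2).const_mul 1)).sub
    (((hp 3).pow 2).const_mul (1 / (2 * Real.sqrt 2)))).const_mul (1 / 2 : ℝ)).sub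
    (hn.rpow_const (p := -(1 : ℝ) / 2) (Or.inl (by positivity)))
  refine h.congr_fderiv ?_
  have hnx : ‖x‖ ^ 2 + 1 = 1 + y ^ 2 := by
    simp [hx, norm_smul]; ring
  have hr : (1 + y ^ 2) ^ (-(1 : ℝ) / 2 - 1) = (√(1 + y ^ 2) ^ 3)⁻¹ := by
    rw [Real.sqrt_eq_rpow, ← Real.rpow_mul_natCast (by positivity), ← Real.rpow_neg (by positivity)]
    norm_num
  ext w
  rw [hnx, hr]
  simp [hx, EuclideanSpace.inner_single_left]
  ring

/-- Example 7.2: for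
`V(x) = ½((7/2)x₁² - x₂² - (1/(2√2))x₄²) - (‖x‖² + 1)^{-1/2}` on `ℝ⁴`, the
system `ẍ = -∇V(x)` has a non-stationary `2π`-periodic solution. -/
theorem example_7_2
    (V : EuclideanSpace ℝ (Fin 4) → ℝ)
    (hVdef : ∀ x : EuclideanSpace ℝ (Fin 4),
      V x = (1 / 2 : ℝ) * ((7 / 2) * (x 0) ^ 2 - 1 * (x 1) ^ 2
          - (1 / (2 * Real.sqrt 2)) * (x 3) ^ 2)
        - (‖x‖ ^ 2 + 1) ^ (-(1 : ℝ) / 2)) :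
    ∃ u : ℝ → EuclideanSpace ℝ (Fin 4),
      ContDiff ℝ 2 u ∧ (∀ t, u (t + 2 * π) = u t) ∧
      (∀ t, deriv (deriv u) t = -gradient V (u t)) ∧
      ¬(∃ c : EuclideanSpace ℝ (Fin 4), ∀ t, u t = c) := by
  obtain ⟨y, y', hy, hy', hper, t₁, t₂, hne⟩ := exists_scalar_solution
  set e : EuclideanSpace ℝ (Fin 4) := EuclideanSpace.single 0 (1 : ℝ) with he
  have hu : deriv (fun t => y t • e) = fun t => y' t • e :=
    funext fun t => ((hy t).smul_const e).deriv
  have hu' : deriv (fun t => y' t • e) =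
      fun t => (-(y t * (7 / 2 + (√(1 + y t ^ 2) ^ 3)⁻¹))) • e :=
    funext fun t => ((hy' t).smul_const e).deriv
  have hyc : Continuous y := continuous_iff_continuousAt.2 fun t => (hy t).continuousAt
  refine ⟨fun t => y t • e, ?_, fun t => ?_, fun t => ?_, ?_⟩
  · rw [show (2 : WithTop ℕ∞) = 1 + 1 by norm_num, contDiff_succ_iff_deriv, hu,
      contDiff_one_iff_deriv, hu']
    refine ⟨fun t => ((hy t).smul_const e).differentiableAt, by simp,
      fun t => ((hy' t).smul_const e).differentiableAt, ?_⟩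
    refine Continuous.smul (Continuous.neg (hyc.mul (continuous_const.add
      (Continuous.inv₀ (by fun_prop) fun t => ?_)))) continuous_const
    positivity
  · beta_reduce
    rw [two_mul, ← add_assoc, hper, hper]
  · rw [hu, hu']
    beta_reduce
    rw [(hasGradientAt_potential V hVdef (y t)).gradient, neg_smul]
  · rintro ⟨c, hc⟩
    have h : y t₁ • e = y t₂ • e := (hc t₁).trans (hc t₂).symm
    exact hne (smul_left_injective ℝ (by simp [he]) h)
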